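/- arXiv:2209.02849 — 4 statements merged into one kernel-verified Lean document; each statement's English description precedes it below -/
import Mathlib

section
/- Suppose the simplicity set S is admissible for an adaptive trajectory with horizon N (in particular the adaptive dynamics hold and S ⊆ {1,…,N−1}). Then the lifted state trajectory coincides with the solution of the complex dynamical system under the lifted controls: x^l_i = φ(i, x^l_0, u^l) for every i = 0, 1, …, N, where u^l = (u^l_0,…,u^l_{N−1}) is the lifted control sequence. -/
/-- Abstract adaptive-complexity MPC framework: complex system, simple system,
reduction `red` (ψ) with state component `redx` (ψ_x), lift `lift` (ψ†) with state
component `liftx` (ψ†_x), satisfying ψ ∘ ψ† = id. -/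
structure ACSys (Xc Uc Xs Us : Type*) where
  fc : Xc × Uc → Xc
  fs : Xs × Us → Xs
  Zc : Set (Xc × Uc)
  Zs : Set (Xs × Us)
  red : Xc × Uc → Xs × Us
  redx : Xc → Xs
  lift : Xs × Us → Xc × Uc
  liftx : Xs → Xc
  redx_spec : ∀ z : Xc × Uc, (red z).1 = redx z.1
  liftx_spec : ∀ z : Xs × Us, (lift z).1 = liftx z.1
  red_lift : ∀ z : Xs × Us, red (lift z) = z

/-- An adaptive trajectory: complex-space data `(xC i, uC i)` used when `i ∉ S`,
simple-space data `(xS i, uS i)` used when `i ∈ S`. -/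
structure ACTraj (Xc Uc Xs Us : Type*) where
  xC : ℕ → Xc
  uC : ℕ → Uc
  xS : ℕ → Xs
  uS : ℕ → Us

variable {Xc Uc Xs Us : Type*}

/-- The lifted state-control pair `z^l_i`. -/
def zl (A : ACSys Xc Uc Xs Us) (S : Finset ℕ) (T : ACTraj Xc Uc Xs Us) (i : ℕ) : Xc × Uc :=
  if i ∈ S then A.lift (T.xS i, T.uS i) else (T.xC i, T.uC i)

/-- The lifted state `x^l_i`. -/
def xl (A : ACSys Xc Uc Xs Us) (S : Finset ℕ) (T : ACTraj Xc Uc Xs Us) (i : ℕ) : Xc :=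
  if i ∈ S then A.liftx (T.xS i) else T.xC i

/-- The lifted control sequence `u^l`. -/
def ul (A : ACSys Xc Uc Xs Us) (S : Finset ℕ) (T : ACTraj Xc Uc Xs Us) : ℕ → Uc :=
  fun i => (zl A S T i).2

/-- The adaptive dynamics: the four cases according to membership of `i`, `i+1` in `S`. -/
def AdaptDyn (A : ACSys Xc Uc Xs Us) (N : ℕ) (S : Finset ℕ) (T : ACTraj Xc Uc Xs Us) : Prop :=
  ∀ i, i < N →
    (i ∉ S → i + 1 ∉ S → T.xC (i + 1) = A.fc (T.xC i, T.uC i)) ∧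
    (i ∉ S → i + 1 ∈ S → T.xS (i + 1) = A.redx (A.fc (T.xC i, T.uC i))) ∧
    (i ∈ S → i + 1 ∉ S → T.xC (i + 1) = A.fc (A.lift (T.xS i, T.uS i))) ∧
    (i ∈ S → i + 1 ∈ S → T.xS (i + 1) = A.fs (T.xS i, T.uS i))

/-- Admissibility of the simplicity set `S` for an adaptive trajectory:
for each `i ∈ S`, (i) `1 ≤ i ≤ N-1`; (ii) `ψ†(ψ(z^l_i)) ∈ 𝒵^c`;
(iii) `ψ†_x(f^s(ψ(z^l_i))) = f^c(z^l_i)`; (iv) `ψ†_x(ψ_x(f^c(z^l_{i-1}))) = f^c(z^l_{i-1})`. -/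
def AdmissibleSet (A : ACSys Xc Uc Xs Us) (N : ℕ) (S : Finset ℕ) (T : ACTraj Xc Uc Xs Us) : Prop :=
  ∀ i ∈ S,
    (1 ≤ i ∧ i < N) ∧
    A.lift (A.red (zl A S T i)) ∈ A.Zc ∧
    A.liftx (A.fs (A.red (zl A S T i))) = A.fc (zl A S T i) ∧
    A.liftx (A.redx (A.fc (zl A S T (i - 1)))) = A.fc (zl A S T (i - 1))

/-- The solution map φ of the complex system: `φ 0 x u = x`, `φ (i+1) x u = f^c(φ i x u, u i)`. -/
def Phi (A : ACSys Xc Uc Xs Us) : ℕ → Xc → (ℕ → Uc) → Xc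
  | 0, x, _ => x
  | i + 1, x, u => A.fc (Phi A i x u, u i)

/-- Feasibility of an adaptive trajectory for the adaptive OCP `P^a(x)` with horizon `N`
and terminal set `Xt`. -/
def FeasAdapt (A : ACSys Xc Uc Xs Us) (N : ℕ) (S : Finset ℕ) (T : ACTraj Xc Uc Xs Us)
    (Xt : Set Xc) (x : Xc) : Prop :=
  T.xC 0 = x ∧ (∀ i ∈ S, (T.xS i, T.uS i) ∈ A.Zs) ∧
    (∀ i, i < N → i ∉ S → (T.xC i, T.uC i) ∈ A.Zc) ∧ T.xC N ∈ Xt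

/-- A terminal control law for terminal set `Xt`. -/
def TermLaw (A : ACSys Xc Uc Xs Us) (Xt : Set Xc) (ht : Xc → Uc) : Prop :=
  ∀ x ∈ Xt, (x, ht x) ∈ A.Zc ∧ A.fc (x, ht x) ∈ Xt

/-- Feasibility of a control sequence for the complex OCP `P(x)` with horizon `N`. -/
def FeasComplex (A : ACSys Xc Uc Xs Us) (N : ℕ) (Xt : Set Xc) (x : Xc) (u : ℕ → Uc) : Prop :=
  (∀ i, i < N → (Phi A i x u, u i) ∈ A.Zc) ∧ Phi A N x u ∈ Xt

/-- The adaptive feasibility region `X_N`. -/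
def XNreg (A : ACSys Xc Uc Xs Us) (N : ℕ) (Xt : Set Xc) : Set Xc :=
  {x | ∃ (S : Finset ℕ) (T : ACTraj Xc Uc Xs Us),
    AdmissibleSet A N S T ∧ AdaptDyn A N S T ∧ FeasAdapt A N S T Xt x}

/-- The set of states admitting a feasible complex OCP solution with horizon `N`. -/
def XcplxSet (A : ACSys Xc Uc Xs Us) (N : ℕ) (Xt : Set Xc) : Set Xc :=
  {x | ∃ u : ℕ → Uc, FeasComplex A N Xt x u}

/-- The cost of an adaptive trajectory: `Σ_{i<N} L^c(z^l_i) + V_t(x^l_N)`. -/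
noncomputable def trajCost (A : ACSys Xc Uc Xs Us) (N : ℕ) (S : Finset ℕ)
    (T : ACTraj Xc Uc Xs Us) (Lc : Xc × Uc → ℝ) (Vt : Xc → ℝ) : ℝ :=
  (∑ i ∈ Finset.range N, Lc (zl A S T i)) + Vt (xl A S T N)

/-- The optimal value `V*_N(x)`: infimum of costs over admissible simplicity sets and
feasible adaptive trajectories for `P^a(x)`. -/
noncomputable def Vstar (A : ACSys Xc Uc Xs Us) (N : ℕ) (Xt : Set Xc)
    (Lc : Xc × Uc → ℝ) (Vt : Xc → ℝ) (x : Xc) : ℝ :=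
  sInf {c | ∃ (S : Finset ℕ) (T : ACTraj Xc Uc Xs Us),
    AdmissibleSet A N S T ∧ AdaptDyn A N S T ∧ FeasAdapt A N S T Xt x ∧
    c = trajCost A N S T Lc Vt}

/-- under admissibility of `S`, the lifted state trajectory coincides with the
solution of the complex system under the lifted controls. -/
theorem lifted_state_matches_complex_solution
    (A : ACSys Xc Uc Xs Us) (N : ℕ) (S : Finset ℕ) (T : ACTraj Xc Uc Xs Us)
    (hdyn : AdaptDyn A N S T) (hadm : AdmissibleSet A N S T) :
    ∀ i ≤ N, xl A S T i = Phi A i (xl A S T 0) (ul A S T) := by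
  intro i
  induction i with
  | zero => intro _; rfl
  | succ i ih =>
    intro hi
    have h := ih (by omega)
    have hz : (Phi A i (xl A S T 0) (ul A S T), ul A S T i) = zl A S T i := by
      rw [← h]
      by_cases hS : i ∈ S
      · simp [xl, ul, zl, hS, ← A.liftx_spec (T.xS i, T.uS i)]
      · simp [xl, ul, zl, hS]
    change _ = A.fc (Phi A i (xl A S T 0) (ul A S T), ul A S T i)
    rw [hz]
    obtain ⟨h1, h2, h3, h4⟩ := hdyn i (by omega)
    by_cases hS : i ∈ S <;> by_cases hS' : i + 1 ∈ S
    · have h5 := (hadm i hS).2.2.1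
      rw [← h5]
      simp [xl, zl, hS, hS', A.red_lift, h4 hS hS']
    · simp [xl, zl, hS, hS', h3 hS hS']
    · have h5 := (hadm (i + 1) hS').2.2.2
      simp only [Nat.add_sub_cancel] at h5
      rw [← h5]
      simp [xl, zl, hS, hS', h2 hS hS']
    · simp [xl, zl, hS, hS', h1 hS hS']
end

section
/- (Recursive feasibility.) Let h_t be a terminal control law for terminal set 𝒳_t. Suppose S is an admissible simplicity set for an adaptive trajectory that is feasible for the adaptive OCP P^a(x) with horizon N, with lifted controls u^l_0,…,u^l_{N−1}. Let x̂ = φ(N, x, u^l) be the predicted terminal state and let x⁺ = f^c(x, u^l_0) be the successor state. Then the shifted control sequence ũ = (u^l_1, …, u^l_{N−1}, h_t(x̂)) is a feasible solution of the complex OCP P(x⁺) with horizon N: the states x̃_0 = x⁺, x̃_{j+1} = f^c(x̃_j, ũ_j) satisfy (x̃_j, ũ_j) ∈ 𝒵^c for all j = 0,…,N−1 and x̃_N ∈ 𝒳_t. -/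
variable {Xc Uc Xs Us : Type*}

theorem zl_fst_aux (A : ACSys Xc Uc Xs Us) (S : Finset ℕ) (T : ACTraj Xc Uc Xs Us) (i : ℕ) :
    zl A S T i = (xl A S T i, ul A S T i) := by
  unfold ul
  refine Prod.ext ?_ rfl
  unfold zl xl
  split_ifs
  · exact A.liftx_spec _
  · rfl

theorem xl_succ_aux (A : ACSys Xc Uc Xs Us) (N : ℕ) (S : Finset ℕ) (T : ACTraj Xc Uc Xs Us)
    (hadm : AdmissibleSet A N S T) (hdyn : AdaptDyn A N S T) (i : ℕ) (hi : i < N) :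
    xl A S T (i + 1) = A.fc (zl A S T i) := by
  obtain ⟨h1, h2, h3, h4⟩ := hdyn i hi
  by_cases a : i ∈ S <;> by_cases b : i + 1 ∈ S
  · have h := (hadm i a).2.2.1
    simp only [zl, xl, a, b, if_true, A.red_lift] at h ⊢
    rw [h4 a b, h]
  · simp only [zl, xl, a, b, if_true, if_false]
    exact h3 a b
  · have h := (hadm (i + 1) b).2.2.2
    simp only [Nat.add_sub_cancel, zl, xl, a, b, if_true, if_false] at h ⊢
    rw [h2 a b, h]
  · simp only [zl, xl, a, b, if_false]
    exact h1 a b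

theorem zl_mem_aux (A : ACSys Xc Uc Xs Us) (N : ℕ) (S : Finset ℕ) (T : ACTraj Xc Uc Xs Us)
    (Xt : Set Xc) (x : Xc) (hadm : AdmissibleSet A N S T) (hfeas : FeasAdapt A N S T Xt x)
    (i : ℕ) (hi : i < N) : zl A S T i ∈ A.Zc := by
  by_cases a : i ∈ S
  · have h := (hadm i a).2.1
    simpa only [zl, a, if_true, A.red_lift] using h
  · simpa only [zl, a, if_false] using hfeas.2.2.1 i hi a

/-- recursive feasibility: the shifted control sequence
`(u^l_1, …, u^l_{N−1}, h_t(x̂))` is feasible for the complex OCP at the successor state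
`x⁺ = f^c(x, u^l_0)`. -/
theorem recursive_feasibility
    (A : ACSys Xc Uc Xs Us) (N : ℕ) (hN : 1 ≤ N) (Xt : Set Xc) (ht : Xc → Uc)
    (hht : TermLaw A Xt ht)
    (S : Finset ℕ) (T : ACTraj Xc Uc Xs Us)
    (hadm : AdmissibleSet A N S T) (hdyn : AdaptDyn A N S T)
    (x : Xc) (hfeas : FeasAdapt A N S T Xt x) :
    FeasComplex A N Xt (A.fc (x, ul A S T 0))
      (fun j => if j + 1 < N then ul A S T (j + 1)
                else ht (Phi A N x (ul A S T))) := by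
  have h0 : xl A S T 0 = x := by
    have : 0 ∉ S := fun h => by have := (hadm 0 h).1.1; omega
    simp only [xl, this, if_false]
    exact hfeas.1
  have hNt : xl A S T N ∈ Xt := by
    have : N ∉ S := fun h => by have := (hadm N h).1.2; omega
    simp only [xl, this, if_false]
    exact hfeas.2.2.2
  have hphi : ∀ i, i ≤ N → Phi A i x (ul A S T) = xl A S T i := by
    intro i
    induction i with
    | zero => intro _; exact h0.symm
    | succ k ih =>
      intro hk
      rw [xl_succ_aux A N S T hadm hdyn k (by omega), zl_fst_aux, ← ih (by omega)]
      rfl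
  rw [hphi N le_rfl]
  set u : ℕ → Uc := fun j => if j + 1 < N then ul A S T (j + 1) else ht (xl A S T N) with hu
  have hsh : ∀ j, j + 1 ≤ N → Phi A j (A.fc (x, ul A S T 0)) u = xl A S T (j + 1) := by
    intro j
    induction j with
    | zero =>
      intro hk
      rw [xl_succ_aux A N S T hadm hdyn 0 (by omega), zl_fst_aux, h0]
      rfl
    | succ k ih =>
      intro hk
      have e : u k = ul A S T (k + 1) := by
        simp only [hu]
        exact if_pos (by omega)
      rw [xl_succ_aux A N S T hadm hdyn (k + 1) (by omega), zl_fst_aux, ← ih (by omega), ← e]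
      rfl
  obtain ⟨M, rfl⟩ : ∃ M, N = M + 1 := ⟨N - 1, by omega⟩
  have eM : u M = ht (xl A S T (M + 1)) := by
    simp only [hu]
    exact if_neg (by omega)
  refine ⟨fun i hi => ?_, ?_⟩
  · rw [hsh i (by omega)]
    rcases Nat.lt_or_ge i M with h | h
    · have e : u i = ul A S T (i + 1) := by
        simp only [hu]
        exact if_pos (by omega)
      rw [e, ← zl_fst_aux]
      exact zl_mem_aux A _ S T Xt x hadm hfeas _ (by omega)
    · obtain rfl : i = M := by omega
      rw [eM]
      exact (hht _ hNt).1
  · change A.fc (Phi A M _ u, u M) ∈ Xt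
    rw [hsh M le_rfl, eM]
    exact (hht _ hNt).2
end

section
/- (Positive invariance of the adaptive feasibility region.) Let h_t be a terminal control law for terminal set 𝒳_t and define the adaptive feasibility region X_N as the set of x ∈ X^c for which there exist an admissible simplicity set S and a feasible adaptive trajectory for the adaptive OCP P^a(x) with horizon N. If x ∈ X_N, witnessed by an admissible S and a feasible adaptive trajectory with lifted controls u^l, then the successor state x⁺ = f^c(x, u^l_0) also lies in X_N. In particular, X_N is positively invariant under the closed-loop adaptive-complexity MPC system x_{k+1} = f^c(x_k, u^l_{0|k}). -/
variable {Xc Uc Xs Us : Type*}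

/-- positive invariance of the adaptive feasibility region: if `x ∈ X_N` is
witnessed by an admissible `S` and a feasible adaptive trajectory with lifted controls `u^l`,
then the successor state `f^c(x, u^l_0)` also lies in `X_N`; in particular `X_N` is positively
invariant under the closed-loop adaptive-complexity MPC system. -/
theorem adaptive_region_positively_invariant
    (A : ACSys Xc Uc Xs Us) (N : ℕ) (hN : 1 ≤ N) (Xt : Set Xc) (ht : Xc → Uc)
    (hht : TermLaw A Xt ht)
    (S : Finset ℕ) (T : ACTraj Xc Uc Xs Us)
    (hadm : AdmissibleSet A N S T) (hdyn : AdaptDyn A N S T)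
    (x : Xc) (hfeas : FeasAdapt A N S T Xt x) :
    A.fc (x, ul A S T 0) ∈ XNreg A N Xt := by
  obtain ⟨h0, hS, hC, hT⟩ := hfeas
  have hNS : N ∉ S := fun h => by have := (hadm N h).1.2; omega
  have h0S : 0 ∉ S := fun h => by have := (hadm 0 h).1.1; omega
  have hz : ∀ i, zl A S T i = (xl A S T i, ul A S T i) := by
    intro i
    refine Prod.ext ?_ rfl
    by_cases hi : i ∈ S
    · simp [zl, xl, hi, A.liftx_spec]
    · simp [zl, xl, hi]
  have hstep : ∀ i, i < N → xl A S T (i + 1) = A.fc (zl A S T i) := by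
    intro i hi
    obtain ⟨h1, h2, h3, h4⟩ := hdyn i hi
    by_cases ha : i ∈ S
    · by_cases hb : i + 1 ∈ S
      · have h := (hadm i ha).2.2.1
        simp only [zl, ha, if_true, A.red_lift] at h
        simp only [xl, zl, ha, hb, if_true, h4 ha hb, h]
      · simp [xl, zl, ha, hb, h3 ha hb]
    · by_cases hb : i + 1 ∈ S
      · have h := (hadm (i + 1) hb).2.2.2
        simp only [zl, Nat.add_sub_cancel, ha, if_false] at h
        simp only [xl, zl, ha, hb, if_true, if_false, h2 ha hb, h]
      · simp [xl, zl, ha, hb, h1 ha hb]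
  have hmem : ∀ i, i < N → zl A S T i ∈ A.Zc := by
    intro i hi
    by_cases ha : i ∈ S
    · have h := (hadm i ha).2.1
      simp only [zl, ha, if_true, A.red_lift] at h ⊢
      exact h
    · simpa [zl, ha] using hC i hi ha
  have hxN : xl A S T N = T.xC N := by simp [xl, hNS]
  obtain ⟨ht1, ht2⟩ := hht _ hT
  refine ⟨∅, ⟨fun i => if i < N then xl A S T (i + 1) else A.fc (T.xC N, ht (T.xC N)),
    fun i => if i + 1 < N then ul A S T (i + 1) else ht (T.xC N), T.xS, T.uS⟩, ?_, ?_, ?_, ?_, ?_, ?_⟩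
  · intro i hi
    simp at hi
  · intro i hi
    refine ⟨fun _ _ => ?_, fun _ h => by simp at h, fun h => by simp at h, fun h => by simp at h⟩
    by_cases hi' : i + 1 < N
    · simp only [hi, hi', if_true]
      rw [hstep _ hi', hz]
    · have : i + 1 = N := by omega
      simp only [hi, hi', if_true, if_false]
      rw [this, hxN]
  · have h : 0 < N := hN
    simp only [h, if_true]
    rw [hstep 0 h, hz 0]
    simp [xl, h0S, h0]
  · intro i hi
    simp at hi
  · intro i hi _
    by_cases hi' : i + 1 < N
    · simp only [hi, hi', if_true]
      rw [← hz]
      exact hmem _ hi'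
    · have : i + 1 = N := by omega
      simp only [hi, hi', if_true, if_false]
      rw [this, hxN]
      exact ht1
  · simpa using ht2
end

section
/- (Feasible adaptive solutions lift to feasible complex solutions.) Suppose S is an admissible simplicity set for an adaptive trajectory that is feasible for the adaptive OCP P^a(x) with horizon N and terminal set 𝒳_t, and let u^l_0,…,u^l_{N−1} be its lifted controls. Then u^l is a feasible solution of the complex OCP P(x) with horizon N: the states x̃_0 = x, x̃_{i+1} = f^c(x̃_i, u^l_i) satisfy (x̃_i, u^l_i) ∈ 𝒵^c for all i = 0,…,N−1 and x̃_N ∈ 𝒳_t. -/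
variable {Xc Uc Xs Us : Type*}

/-- feasible adaptive solutions lift to feasible complex solutions. -/
theorem adaptive_feasible_lifts_to_complex_feasible
    (A : ACSys Xc Uc Xs Us) (N : ℕ) (Xt : Set Xc)
    (S : Finset ℕ) (T : ACTraj Xc Uc Xs Us)
    (hadm : AdmissibleSet A N S T) (hdyn : AdaptDyn A N S T)
    (x : Xc) (hfeas : FeasAdapt A N S T Xt x) :
    FeasComplex A N Xt x (ul A S T) := by
  obtain ⟨h0, -, hZ, hT⟩ := hfeas
  have h0S : 0 ∉ S := fun h => absurd (hadm 0 h).1.1 (by omega)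
  have hNS : N ∉ S := fun h => absurd (hadm N h).1.2 (by omega)
  have step : ∀ i, i < N → (zl A S T (i + 1)).1 = A.fc (zl A S T i) := by
    intro i hi
    obtain ⟨d1, d2, d3, d4⟩ := hdyn i hi
    by_cases hs : i ∈ S
    · have hz : zl A S T i = A.lift (T.xS i, T.uS i) := by simp [zl, hs]
      by_cases hs1 : i + 1 ∈ S
      · have h3 := (hadm i hs).2.2.1
        have hz1 : zl A S T (i + 1) = A.lift (T.xS (i + 1), T.uS (i + 1)) := by simp [zl, hs1]
        rw [hz1, A.liftx_spec, ← h3, hz, A.red_lift, ← d4 hs hs1]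
      · have hz1 : zl A S T (i + 1) = (T.xC (i + 1), T.uC (i + 1)) := by simp [zl, hs1]
        rw [hz1, hz, ← d3 hs hs1]
    · have hz : zl A S T i = (T.xC i, T.uC i) := by simp [zl, hs]
      by_cases hs1 : i + 1 ∈ S
      · have h4 := (hadm (i + 1) hs1).2.2.2
        have hz1 : zl A S T (i + 1) = A.lift (T.xS (i + 1), T.uS (i + 1)) := by simp [zl, hs1]
        rw [Nat.add_sub_cancel] at h4
        rw [hz1, A.liftx_spec, ← h4, hz, ← d2 hs hs1]
      · have hz1 : zl A S T (i + 1) = (T.xC (i + 1), T.uC (i + 1)) := by simp [zl, hs1]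
        rw [hz1, hz, ← d1 hs hs1]
  have key : ∀ i, i ≤ N → Phi A i x (ul A S T) = (zl A S T i).1 := by
    intro i
    induction i with
    | zero => intro _; simp [Phi, zl, h0S, h0]
    | succ k ih =>
      intro hk
      rw [step k (by omega)]
      simp only [Phi]
      rw [ih (by omega)]
      rfl
  refine ⟨fun i hi => ?_, ?_⟩
  · rw [key i hi.le]
    change zl A S T i ∈ A.Zc
    by_cases hs : i ∈ S
    · have h2 := (hadm i hs).2.1
      have hz : zl A S T i = A.lift (T.xS i, T.uS i) := by simp [zl, hs]
      rw [hz, A.red_lift] at h2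
      rwa [hz]
    · have hz : zl A S T i = (T.xC i, T.uC i) := by simp [zl, hs]
      rw [hz]
      exact hZ i hi hs
  · rw [key N le_rfl]
    simpa [zl, hNS] using hT
end
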